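/- Let q ≥ 3 be an integer, N = (q−2)/2 if q is even and N = q−2 if q is odd, and b_l (0 ≤ l ≤ N−1) as in the context. Let s be a nonempty finite index set and d : s → ℕ with d(i) ≥ 3 and 1 − ((q−2)/(2q))·d(i) ≤ 0 for every i ∈ s, and set κ = (2q/(q−2))·(1/|s|)·Σ_{i∈s} (1 − ((q−2)/(2q))·d(i)). Then for all l with 0 ≤ l ≤ N−1: (1) b_l − κ ≥ 2 if q ∈ {3,4} and l = (N−1)/2 (= 0); (2) b_l − κ ≥ 1 if l ≠ (N−1)/2 or q is even; (3) b_l − κ ≥ 0 if q = 5 and l = (N−1)/2 (= 1); (4) b_l − κ ≥ −1 if q ≥ 7 is odd and l = (N−1)/2. -/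

import Mathlib

/-- If all degrees are at least `m`, then `4/(q-2)` minus the normalized average curvature is at
least `m - 2`. -/
theorem sub_two_le_sub_normalized_average {ι : Type*} {q : ℝ} (hq : 2 < q) {s : Finset ι}
    (hs : s.Nonempty) {d : ι → ℕ} {m : ℕ} (hm : ∀ i ∈ s, m ≤ d i) :
    (m : ℝ) - 2 ≤ 4 / (q - 2) - (2 * q / (q - 2)) * (1 / (s.card : ℝ)) *
        ∑ i ∈ s, (1 - ((q - 2) / (2 * q)) * (d i : ℝ)) := by
  have hq2 : q - 2 ≠ 0 := by linarith
  have hq0 : q ≠ 0 := by linarith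
  have hc : (0 : ℝ) < s.card := by exact_mod_cast hs.card_pos
  have hsum : (s.card : ℝ) * m ≤ ∑ i ∈ s, (d i : ℝ) := by
    simpa using s.card_nsmul_le_sum (fun i => (d i : ℝ)) m fun i hi => by exact_mod_cast hm i hi
  have havg : (m : ℝ) ≤ (∑ i ∈ s, (d i : ℝ)) / s.card := by
    rw [le_div_iff₀ hc]
    linarith
  have heq : 4 / (q - 2) - (2 * q / (q - 2)) * (1 / (s.card : ℝ)) *
      ∑ i ∈ s, (1 - ((q - 2) / (2 * q)) * (d i : ℝ)) =
      (∑ i ∈ s, (d i : ℝ)) / s.card - 2 := by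
    rw [Finset.sum_sub_distrib, ← Finset.mul_sum, Finset.sum_const, nsmul_eq_mul, mul_one]
    field_simp
    ring
  linarith

/-- STATEMENT 12 (the paper's Lemma 4.1), stated with `κ` equal to the normalized average
`(2q/(q-2))·(1/|s|)·Σ_{i∈s} (1 - ((q-2)/(2q))·d i)` of non-positive vertex curvatures of
degrees `d i ≥ 3`.  Here `N = (q-2)/2` for `q` even and `N = q-2` for `q` odd, and
`b l = 4/(q-2)` except `b ((N-1)/2) = 4/(q-2) - 2` when `q` is odd. -/
theorem b_minus_kappa_bounds {ι : Type*} (q : ℕ) (hq : 3 ≤ q)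
    (N : ℕ) (hN : N = if Even q then (q - 2) / 2 else q - 2)
    (b : ℕ → ℝ)
    (hb : ∀ l, l ≤ N - 1 →
      b l = if ¬ Even q ∧ l = (N - 1) / 2 then 4 / ((q : ℝ) - 2) - 2 else 4 / ((q : ℝ) - 2))
    (s : Finset ι) (hs : s.Nonempty) (d : ι → ℕ)
    (hd3 : ∀ i ∈ s, 3 ≤ d i)
    (hdcurv : ∀ i ∈ s, 1 - (((q : ℝ) - 2) / (2 * q)) * (d i : ℝ) ≤ 0)
    (κ : ℝ)
    (hκ : κ = (2 * (q : ℝ) / ((q : ℝ) - 2)) * (1 / (s.card : ℝ)) *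
        ∑ i ∈ s, (1 - (((q : ℝ) - 2) / (2 * q)) * (d i : ℝ)))
    (l : ℕ) (hl : l ≤ N - 1) :
    ((q = 3 ∨ q = 4) → l = (N - 1) / 2 → 2 ≤ b l - κ) ∧
    ((Even q ∨ l ≠ (N - 1) / 2) → 1 ≤ b l - κ) ∧
    (q = 5 → l = (N - 1) / 2 → 0 ≤ b l - κ) ∧
    (¬ Even q → 7 ≤ q → l = (N - 1) / 2 → -1 ≤ b l - κ) := by
  have bound (m : ℕ) (hm : ∀ i ∈ s, m ≤ d i) : (m : ℝ) - 2 ≤ 4 / ((q : ℝ) - 2) - κ := by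
    rw [hκ]
    exact sub_two_le_sub_normalized_average (by exact_mod_cast hq) hs hm
  have h3 := bound 3 hd3
  rw [hb l hl]
  refine ⟨?_, ?_, ?_, ?_⟩
  · rintro (rfl | rfl) hl'
    · have h := bound 6 fun i hi => by
        have := hdcurv i hi
        norm_num at this
        have : (6 : ℝ) ≤ d i := by linarith
        exact_mod_cast this
      rw [if_pos ⟨by decide, hl'⟩]
      norm_num at h ⊢
      linarith
    · have h := bound 4 fun i hi => by
        have := hdcurv i hi
        norm_num at this
        have : (4 : ℝ) ≤ d i := by linarith
        exact_mod_cast this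
      rw [if_neg fun h => h.1 (by decide)]
      norm_num at h ⊢
      linarith
  · intro h
    rw [if_neg (by tauto)]
    norm_num at h3
    linarith
  · rintro rfl hl'
    have h := bound 4 fun i hi => by
      have := hdcurv i hi
      norm_num at this
      have : (3 : ℝ) < d i := by linarith
      exact_mod_cast this
    rw [if_pos ⟨by decide, hl'⟩]
    norm_num at h ⊢
    linarith
  · intro hodd _ hl'
    rw [if_pos ⟨hodd, hl'⟩]
    norm_num at h3
    linarith
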